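/- For every n ≥ 1 and k ≥ 0, the number of fully commutative elements of Coxeter length k in the symmetric group S_{n+1} equals the number of Dyck paths of semi-length n+1 with (sum of peak heights) − (number of peaks) = k. -/

import Mathlib

attribute [local instance] Classical.propDecidable

/-- The set of Dyck paths of semi-length `n`, encoded as the set `U ⊆ {0, …, 2n-1}` of
positions of up-steps, such that there are `n` up-steps and every prefix has at least
as many up-steps as down-steps. -/
noncomputable def dyckPaths (n : ℕ) : Finset (Finset ℕ) :=
  (Finset.range (2 * n)).powerset.filter
    (fun U => U.card = n ∧ ∀ t ∈ Finset.range (2 * n + 1), t ≤ 2 * (U ∩ Finset.range t).card)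

/-- The set of positions `i` at which the Dyck path (with up-step set `U`) has a peak:
an up-step at `i` immediately followed by a down-step at `i+1`. -/
def peakSet (n : ℕ) (U : Finset ℕ) : Finset ℕ :=
  (Finset.range (2 * n)).filter (fun i => i ∈ U ∧ i + 1 ∉ U ∧ i + 1 < 2 * n)

/-- The height of the peak at position `i`: the y-coordinate after the up-step at `i`. -/
def peakHeight (U : Finset ℕ) (i : ℕ) : ℕ :=
  2 * (U ∩ Finset.range (i + 1)).card - (i + 1)

/-- The statistic (sum of peak heights) − (number of peaks) of a Dyck path. -/
def statDiff (n : ℕ) (U : Finset ℕ) : ℕ :=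
  (∑ i ∈ peakSet n U, peakHeight U i) - (peakSet n U).card

/-- `T n k` is the number of Dyck paths of semi-length `n` with
(sum of peak heights) − (number of peaks) equal to `k`. -/
noncomputable def T (n k : ℕ) : ℕ :=
  ((dyckPaths n).filter (fun U => statDiff n U = k)).card

/-- The `i`-th simple transposition `sₙ i = (i-1, i)` in the symmetric group `S_{n+1}`
on `{0, …, n}`, for `1 ≤ i ≤ n` (and the identity otherwise).  In the usual
`1`-based labelling this is the simple transposition `s_i` swapping `i` and `i+1`. -/
def sgen (n : ℕ) (i : ℕ) : Equiv.Perm (Fin (n + 1)) :=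
  if h : 0 < i ∧ i ≤ n then Equiv.swap ⟨i - 1, by omega⟩ ⟨i, by omega⟩ else 1

/-- The segment `T_i^j = s_j s_{j-1} ⋯ s_{i+1} s_i` (the identity when `i > j`). -/
def seg (n i j : ℕ) : Equiv.Perm (Fin (n + 1)) :=
  ((List.range' i (j + 1 - i)).reverse.map (sgen n)).prod

/-- The decreasing word `[j, j-1, …, i+1, i]` spelling the segment `T_i^j`. -/
def segWord (i j : ℕ) : List ℕ :=
  (List.range' i (j + 1 - i)).reverse

/-- The product of the word `l` of simple transpositions in `S_{n+1}`. -/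
def wprod (n : ℕ) (l : List ℕ) : Equiv.Perm (Fin (n + 1)) :=
  (l.map (sgen n)).prod

/-- `l` is a reduced word for `w`: a word in the letters `1, …, n` of minimal length
whose product of simple transpositions is `w`. -/
def IsReducedWord (n : ℕ) (w : Equiv.Perm (Fin (n + 1))) (l : List ℕ) : Prop :=
  (∀ i ∈ l, 1 ≤ i ∧ i ≤ n) ∧ wprod n l = w ∧
    ∀ l' : List ℕ, (∀ i ∈ l', 1 ≤ i ∧ i ≤ n) → wprod n l' = w → l.length ≤ l'.length

/-- `w` is fully commutative: no reduced word for `w` contains a factor `[i, i', i]`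
with `|i - i'| = 1`. -/
def FullyCommutative (n : ℕ) (w : Equiv.Perm (Fin (n + 1))) : Prop :=
  ∀ l : List ℕ, IsReducedWord n w l →
    ∀ i i' : ℕ, (i + 1 = i' ∨ i' + 1 = i) → ¬ ([i, i', i] <:+: l)

/-- The set of inversions of a permutation, as pairs of positions. -/
def inversions {N : ℕ} (w : Equiv.Perm (Fin N)) : Finset (Fin N × Fin N) :=
  Finset.univ.filter fun x => x.1 < x.2 ∧ w x.2 < w x.1

/-- A permutation avoids the pattern `321` if it has no decreasing subsequence of length three. -/
def Avoids321 {N : ℕ} (w : Equiv.Perm (Fin N)) : Prop :=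
  ∀ a b c, a < b → b < c → w b < w a → ¬ w c < w b

/-- Position `i` is a record of `f` if `f i` exceeds all earlier values. -/
def IsRecord {N : ℕ} (f : Fin N → Fin N) (i : Fin N) : Prop :=
  ∀ j < i, f j < f i

/-- The running maximum of `f`. -/
def runningMax {N : ℕ} (f : Fin N → Fin N) (i : Fin N) : Fin N :=
  (Finset.Iic i).sup' ⟨i, by simp⟩ f

/-- The position of the `i`-th down-step of the path which has made `M i + 1` up-steps
before it. -/
def downStep {N : ℕ} (M : Fin N → Fin N) (i : Fin N) : ℕ := M i + 1 + i

/-- The set of up-steps of the path whose down-steps are at the positions `downStep M`. -/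
def upSteps {N : ℕ} (M : Fin N → Fin N) : Finset ℕ :=
  Finset.range (2 * N) \ Finset.univ.image (downStep M)

section Length

theorem mem_inversions {N : ℕ} {w : Equiv.Perm (Fin N)} {x : Fin N × Fin N} :
    x ∈ inversions w ↔ x.1 < x.2 ∧ w x.2 < w x.1 := by
  simp [inversions]

theorem sgen_eq_swap {n : ℕ} {p q : Fin (n + 1)} (hpq : (p : ℕ) + 1 = q) :
    sgen n q = Equiv.swap p q := by
  have h : 0 < (q : ℕ) ∧ (q : ℕ) ≤ n := by omega
  rw [sgen, dif_pos h]
  congr 1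
  ext
  simp
  omega

theorem swap_lt_swap {N : ℕ} {p q a b : Fin N} (hpq : (p : ℕ) + 1 = q) (hab : a < b)
    (hne : ¬ (a = p ∧ b = q)) : Equiv.swap p q a < Equiv.swap p q b := by
  simp only [Equiv.swap_apply_def]
  split_ifs <;> omega

theorem card_inversions_mul_swap {N : ℕ} (w : Equiv.Perm (Fin N)) {p q : Fin N}
    (hpq : (p : ℕ) + 1 = q) (h : w p < w q) :
    (inversions (w * Equiv.swap p q)).card = (inversions w).card + 1 := by
  have hlt : p < q := by rw [Fin.lt_def]; omega
  have hmem : (p, q) ∈ inversions (w * Equiv.swap p q) := by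
    simp [mem_inversions, hlt, h]
  rw [← Finset.card_erase_add_one hmem]
  congr 1
  refine Finset.card_nbij' (fun x => (Equiv.swap p q x.1, Equiv.swap p q x.2))
    (fun x => (Equiv.swap p q x.1, Equiv.swap p q x.2)) ?_ ?_ ?_ ?_
  · rintro ⟨a, b⟩ hx
    simp only [Finset.coe_erase, Set.mem_sdiff, Finset.mem_coe, mem_inversions,
      Set.mem_singleton_iff, Prod.mk.injEq, Equiv.Perm.mul_apply] at hx ⊢
    exact ⟨swap_lt_swap hpq hx.1.1 hx.2, hx.1.2⟩
  · rintro ⟨a, b⟩ hx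
    simp only [Finset.coe_erase, Set.mem_sdiff, Finset.mem_coe, mem_inversions,
      Set.mem_singleton_iff, Prod.mk.injEq, Equiv.Perm.mul_apply, Equiv.swap_apply_self] at hx ⊢
    refine ⟨⟨swap_lt_swap hpq hx.1 ?_, by simpa using hx.2⟩, ?_⟩
    · rintro ⟨rfl, rfl⟩
      exact absurd hx.2 h.not_gt
    · rintro ⟨ha, hb⟩
      rw [Equiv.swap_apply_eq_iff, Equiv.swap_apply_left] at ha
      rw [Equiv.swap_apply_eq_iff, Equiv.swap_apply_right] at hb
      exact absurd hx.1 (by rw [ha, hb]; exact hlt.not_gt)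
  · intro x _
    simp
  · intro x _
    simp

theorem card_inversions_eq_mul_swap_add_one {N : ℕ} (w : Equiv.Perm (Fin N)) {p q : Fin N}
    (hpq : (p : ℕ) + 1 = q) (h : w q < w p) :
    (inversions w).card = (inversions (w * Equiv.swap p q)).card + 1 := by
  have := card_inversions_mul_swap (w * Equiv.swap p q) hpq (by simpa using h)
  rwa [mul_assoc, Equiv.swap_mul_self, mul_one] at this

theorem wprod_concat (n : ℕ) (l : List ℕ) (i : ℕ) :
    wprod n (l ++ [i]) = wprod n l * sgen n i := by
  simp [wprod]

/-- An index `1 ≤ i ≤ n` is the larger of two adjacent positions. -/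
theorem exists_adjacent {n i : ℕ} (h : 1 ≤ i ∧ i ≤ n) :
    ∃ p q : Fin (n + 1), (p : ℕ) + 1 = q ∧ (q : ℕ) = i :=
  ⟨⟨i - 1, by omega⟩, ⟨i, by omega⟩, by simp; omega, rfl⟩

theorem card_inversions_wprod_le (n : ℕ) (l : List ℕ) (hl : ∀ i ∈ l, 1 ≤ i ∧ i ≤ n) :
    (inversions (wprod n l)).card ≤ l.length := by
  induction l using List.reverseRecOn with
  | nil =>
    simp only [wprod, List.map_nil, List.prod_nil, List.length_nil, Nat.le_zero,
      Finset.card_eq_zero]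
    ext x
    simp only [mem_inversions, Equiv.Perm.one_apply, Finset.notMem_empty, iff_false, not_and]
    exact fun h => h.not_gt
  | append_singleton l i ih =>
    obtain ⟨p, q, hpq, rfl⟩ := exists_adjacent (hl i (by simp))
    have hl' := ih fun j hj => hl j (by simp [hj])
    rw [wprod_concat, sgen_eq_swap hpq, List.length_append, List.length_singleton]
    have hne : wprod n l p ≠ wprod n l q := by
      intro h
      have := (wprod n l).injective h
      omega
    rcases lt_or_gt_of_ne hne with h | h
    · rw [card_inversions_mul_swap _ hpq h]
      omega
    · have := card_inversions_eq_mul_swap_add_one _ hpq h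
      omega

theorem exists_descent {n : ℕ} {w : Equiv.Perm (Fin (n + 1))} (hw : w ≠ 1) :
    ∃ p q : Fin (n + 1), (p : ℕ) + 1 = q ∧ w q < w p := by
  by_contra! h
  apply hw
  have hmono : StrictMono w := by
    rw [Fin.strictMono_iff_lt_succ]
    intro i
    refine lt_of_le_of_ne (h _ _ (by simp)) fun h' => ?_
    have := w.injective h'
    simp [Fin.ext_iff] at this
  ext i
  have : (w : Fin (n + 1) → Fin (n + 1)) = id :=
    (hmono.range_inj strictMono_id).1 (by simp [w.surjective.range_eq])
  simp [this]

theorem exists_word (n : ℕ) (w : Equiv.Perm (Fin (n + 1))) :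
    ∃ l : List ℕ, (∀ i ∈ l, 1 ≤ i ∧ i ≤ n) ∧ wprod n l = w ∧
      l.length = (inversions w).card := by
  induction hk : (inversions w).card using Nat.strong_induction_on generalizing w with
  | _ k ih =>
    by_cases hw : w = 1
    · subst hw
      have := card_inversions_wprod_le n [] (by simp)
      simp only [wprod, List.map_nil, List.prod_nil, List.length_nil] at this
      exact ⟨[], by simp, by simp [wprod], by simp; omega⟩
    · obtain ⟨p, q, hpq, h⟩ := exists_descent hw
      have hinv := card_inversions_eq_mul_swap_add_one w hpq h
      obtain ⟨l, hl, hprod, hlen⟩ := ih _ (by omega) (w * Equiv.swap p q) rfl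
      refine ⟨l ++ [(q : ℕ)], ?_, ?_, ?_⟩
      · intro i hi
        rcases List.mem_append.1 hi with hi | hi
        · exact hl i hi
        · rw [List.mem_singleton.1 hi]
          omega
      · rw [wprod_concat, hprod, sgen_eq_swap hpq, mul_assoc, Equiv.swap_mul_self, mul_one]
      · simp
        omega

theorem isReducedWord_iff {n : ℕ} {w : Equiv.Perm (Fin (n + 1))} {l : List ℕ} :
    IsReducedWord n w l ↔
      (∀ i ∈ l, 1 ≤ i ∧ i ≤ n) ∧ wprod n l = w ∧ l.length = (inversions w).card := by
  constructor
  · rintro ⟨hl, rfl, hmin⟩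
    obtain ⟨l', hl', hprod, hlen⟩ := exists_word n (wprod n l)
    exact ⟨hl, rfl, le_antisymm (hlen ▸ hmin l' hl' hprod) (card_inversions_wprod_le n l hl)⟩
  · rintro ⟨hl, hprod, hlen⟩
    refine ⟨hl, hprod, fun l' hl' hprod' => ?_⟩
    rw [hlen, ← hprod']
    exact card_inversions_wprod_le n l' hl'

theorem IsReducedWord.concat {n : ℕ} {w : Equiv.Perm (Fin (n + 1))} {l : List ℕ}
    {p q : Fin (n + 1)} (hpq : (p : ℕ) + 1 = q) (h : w q < w p)
    (hl : IsReducedWord n (w * Equiv.swap p q) l) : IsReducedWord n w (l ++ [(q : ℕ)]) := by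
  rw [isReducedWord_iff] at hl ⊢
  refine ⟨?_, ?_, ?_⟩
  · intro i hi
    rcases List.mem_append.1 hi with hi | hi
    · exact hl.1 i hi
    · rw [List.mem_singleton.1 hi]
      omega
  · rw [wprod_concat, hl.2.1, sgen_eq_swap hpq, mul_assoc, Equiv.swap_mul_self, mul_one]
  · rw [card_inversions_eq_mul_swap_add_one w hpq h, ← hl.2.2]
    simp

/-- The last letter of a reduced word is a descent, and removing it leaves a reduced word. -/
theorem IsReducedWord.of_concat {n : ℕ} {w : Equiv.Perm (Fin (n + 1))} {l : List ℕ} {i : ℕ}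
    (h : IsReducedWord n w (l ++ [i])) :
    ∃ p q : Fin (n + 1), (p : ℕ) + 1 = q ∧ (q : ℕ) = i ∧ w q < w p ∧
      IsReducedWord n (w * Equiv.swap p q) l := by
  rw [isReducedWord_iff] at h
  obtain ⟨hl, hprod, hlen⟩ := h
  obtain ⟨p, q, hpq, rfl⟩ := exists_adjacent (hl i (by simp))
  have hl' : ∀ i ∈ l, 1 ≤ i ∧ i ≤ n := fun j hj => hl j (by simp [hj])
  have hw : w * Equiv.swap p q = wprod n l := by
    rw [← hprod, wprod_concat, sgen_eq_swap hpq, mul_assoc, Equiv.swap_mul_self, mul_one]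
  have hle := card_inversions_wprod_le n l hl'
  rw [← hw] at hle
  simp only [List.length_append, List.length_singleton] at hlen
  have hne : w q ≠ w p := by
    intro h
    have := w.injective h
    omega
  have hdesc : w q < w p := by
    refine lt_of_le_of_ne (not_lt.1 fun h => ?_) hne
    have := card_inversions_mul_swap w hpq h
    omega
  refine ⟨p, q, hpq, rfl, hdesc, isReducedWord_iff.2 ⟨hl', hw.symm, ?_⟩⟩
  have := card_inversions_eq_mul_swap_add_one w hpq hdesc
  omega

end Length

section PatternAvoidance

theorem not_avoids321_of_mul_swap {n : ℕ} {w : Equiv.Perm (Fin (n + 1))} {p q : Fin (n + 1)}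
    (hpq : (p : ℕ) + 1 = q) (h : w q < w p) (hw : ¬ Avoids321 (w * Equiv.swap p q)) :
    ¬ Avoids321 w := by
  simp only [Avoids321, not_forall, not_not] at hw
  obtain ⟨a, b, c, hab, hbc, h₁, h₂⟩ := hw
  simp only [Equiv.Perm.mul_apply] at h₁ h₂
  intro hav
  refine hav _ _ _ (swap_lt_swap hpq hab ?_) (swap_lt_swap hpq hbc ?_) h₁ h₂
  · rintro ⟨rfl, rfl⟩
    simp only [Equiv.swap_apply_left, Equiv.swap_apply_right] at h₁
    exact h.not_gt h₁
  · rintro ⟨rfl, rfl⟩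
    simp only [Equiv.swap_apply_left, Equiv.swap_apply_right] at h₂
    exact h.not_gt h₂

theorem not_avoids321_of_reducedWord_braid {n i i' : ℕ} (hi : i + 1 = i' ∨ i' + 1 = i)
    (l₁ l₂ : List ℕ) (w : Equiv.Perm (Fin (n + 1)))
    (hw : IsReducedWord n w (l₁ ++ [i, i', i] ++ l₂)) : ¬ Avoids321 w := by
  induction l₂ using List.reverseRecOn generalizing w with
  | nil =>
    rw [List.append_nil,
      show l₁ ++ [i, i', i] = l₁ ++ [i] ++ [i'] ++ [i] by simp] at hw
    obtain ⟨p, q, hpq, hq, h₁, hw⟩ := hw.of_concat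
    obtain ⟨p', q', hpq', hq', h₂, hw⟩ := hw.of_concat
    obtain ⟨p'', q'', hpq'', hq'', h₃, -⟩ := hw.of_concat
    obtain rfl : q'' = q := by omega
    obtain rfl : p'' = p := by omega
    intro hav
    rcases hi with hi | hi
    · obtain rfl : p' = q'' := by omega
      have hne₁ : q' ≠ p'' := by omega
      have hne₂ : q' ≠ p' := by omega
      have hne₃ : p'' ≠ p' := by omega
      simp only [Equiv.Perm.mul_apply, Equiv.swap_apply_right, Equiv.swap_apply_left,
        Equiv.swap_apply_of_ne_of_ne hne₁ hne₂,
        Equiv.swap_apply_of_ne_of_ne hne₃ hne₁.symm] at h₂ h₃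
      exact hav p'' p' q' (by omega) (by omega) h₁ h₃
    · obtain rfl : q' = p'' := by omega
      have hne₁ : p' ≠ q' := by omega
      have hne₂ : p' ≠ q'' := by omega
      have hne₃ : q'' ≠ q' := by omega
      simp only [Equiv.Perm.mul_apply, Equiv.swap_apply_right, Equiv.swap_apply_left,
        Equiv.swap_apply_of_ne_of_ne hne₁ hne₂,
        Equiv.swap_apply_of_ne_of_ne hne₂.symm hne₃] at h₂ h₃
      exact hav p' q' q'' (by omega) (by omega) h₃ h₁
  | append_singleton l j ih =>
    rw [← List.append_assoc] at hw
    obtain ⟨p, q, hpq, -, hdesc, hw⟩ := hw.of_concat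
    exact not_avoids321_of_mul_swap hpq hdesc (ih _ hw)

theorem exists_reducedWord_braid {n : ℕ} (d : ℕ) (w : Equiv.Perm (Fin (n + 1)))
    (a b c : Fin (n + 1)) (hd : (c : ℕ) ≤ a + d) (hab : a < b) (hbc : b < c)
    (h₁ : w b < w a) (h₂ : w c < w b) :
    ∃ l i, IsReducedWord n w l ∧ [i, i + 1, i] <:+: l := by
  induction d generalizing w a b c with
  | zero => omega
  | succ d ih =>
    have extend {p q : Fin (n + 1)} (hpq : (p : ℕ) + 1 = q) (hdesc : w q < w p)
        (hex : ∃ l i, IsReducedWord n (w * Equiv.swap p q) l ∧ [i, i + 1, i] <:+: l) :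
        ∃ l i, IsReducedWord n w l ∧ [i, i + 1, i] <:+: l := by
      obtain ⟨l, i, hl, hi⟩ := hex
      exact ⟨l ++ [(q : ℕ)], i, hl.concat hpq hdesc, hi.trans (List.prefix_append _ _).isInfix⟩
    by_cases hb : (a : ℕ) + 1 = b
    · by_cases hc : (b : ℕ) + 1 = c
      · have hne₁ : c ≠ a := by omega
        have hne₂ : c ≠ b := by omega
        have hne₃ : a ≠ b := by omega
        obtain ⟨l, hl⟩ : ∃ l, IsReducedWord n
            (w * Equiv.swap a b * Equiv.swap b c * Equiv.swap a b) l := by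
          obtain ⟨l, hl⟩ := exists_word n (w * Equiv.swap a b * Equiv.swap b c * Equiv.swap a b)
          exact ⟨l, isReducedWord_iff.2 hl⟩
        refine ⟨l ++ [(b : ℕ)] ++ [(c : ℕ)] ++ [(b : ℕ)], b, ?_, ⟨l, [], by simp [hc]⟩⟩
        refine IsReducedWord.concat hb h₁ (IsReducedWord.concat hc ?_ (hl.concat hb ?_))
        · simpa [Equiv.swap_apply_of_ne_of_ne hne₁ hne₂] using h₂.trans h₁
        · simpa [Equiv.swap_apply_of_ne_of_ne hne₁ hne₂,
            Equiv.swap_apply_of_ne_of_ne hne₃ hne₁.symm] using h₂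
      · obtain ⟨x, hx⟩ : ∃ x : Fin (n + 1), (x : ℕ) + 1 = c := ⟨⟨c - 1, by omega⟩, by simp; omega⟩
        by_cases hlt : w x < w b
        · exact ih w a b x (by omega) hab (by omega) h₁ hlt
        · have hne : w b ≠ w x := fun h => by have := w.injective h; omega
          have hgt : w b < w x := lt_of_le_of_ne (not_lt.1 hlt) hne
          refine extend hx (h₂.trans hgt) (ih _ a b x (by omega) hab (by omega) ?_ ?_)
          · rwa [Equiv.Perm.mul_apply, Equiv.Perm.mul_apply,
              Equiv.swap_apply_of_ne_of_ne (by omega) (by omega),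
              Equiv.swap_apply_of_ne_of_ne (by omega) (by omega)]
          · rwa [Equiv.Perm.mul_apply, Equiv.Perm.mul_apply, Equiv.swap_apply_left,
              Equiv.swap_apply_of_ne_of_ne (by omega) (by omega)]
    · obtain ⟨x, hx⟩ : ∃ x : Fin (n + 1), (a : ℕ) + 1 = x := ⟨⟨a + 1, by omega⟩, rfl⟩
      by_cases hlt : w b < w x
      · exact ih w x b c (by omega) (by omega) hbc hlt h₂
      · have hne : w x ≠ w b := fun h => by have := w.injective h; omega
        have hgt : w x < w b := lt_of_le_of_ne (not_lt.1 hlt) hne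
        refine extend hx (hgt.trans h₁) (ih _ x b c (by omega) (by omega) hbc ?_ ?_)
        · rwa [Equiv.Perm.mul_apply, Equiv.Perm.mul_apply, Equiv.swap_apply_right,
            Equiv.swap_apply_of_ne_of_ne (by omega) (by omega)]
        · rwa [Equiv.Perm.mul_apply, Equiv.Perm.mul_apply,
            Equiv.swap_apply_of_ne_of_ne (by omega) (by omega),
            Equiv.swap_apply_of_ne_of_ne (by omega) (by omega)]

theorem fullyCommutative_iff_avoids321 {n : ℕ} {w : Equiv.Perm (Fin (n + 1))} :
    FullyCommutative n w ↔ Avoids321 w := by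
  constructor
  · intro hw a b c hab hbc h₁ h₂
    obtain ⟨l, i, hl, hi⟩ :=
      exists_reducedWord_braid c w a b c (by omega) hab hbc h₁ h₂
    exact hw l hl i (i + 1) (Or.inl rfl) hi
  · rintro hw l hl i i' hi ⟨l₁, l₂, rfl⟩
    exact not_avoids321_of_reducedWord_braid hi l₁ l₂ w hl hw

theorem exists_reducedWord_length_iff {n k : ℕ} {w : Equiv.Perm (Fin (n + 1))} :
    (∃ l, IsReducedWord n w l ∧ l.length = k) ↔ (inversions w).card = k := by
  constructor
  · rintro ⟨l, hl, rfl⟩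
    exact (isReducedWord_iff.1 hl).2.2.symm
  · rintro rfl
    obtain ⟨l, hl⟩ := exists_word n w
    exact ⟨l, isReducedWord_iff.2 hl, hl.2.2⟩

end PatternAvoidance

section RunningMax

variable {N : ℕ}

theorem le_runningMax (f : Fin N → Fin N) {i j : Fin N} (h : j ≤ i) : f j ≤ runningMax f i :=
  Finset.le_sup' f (by simpa using h)

theorem exists_eq_runningMax (f : Fin N → Fin N) (i : Fin N) : ∃ j ≤ i, runningMax f i = f j := by
  obtain ⟨j, hj, h⟩ := Finset.exists_mem_eq_sup' (s := Finset.Iic i) ⟨i, by simp⟩ f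
  exact ⟨j, by simpa using hj, h⟩

theorem runningMax_monotone (f : Fin N → Fin N) : Monotone (runningMax f) := by
  intro i j hij
  obtain ⟨k, hk, h⟩ := exists_eq_runningMax f i
  exact h ▸ le_runningMax f (hk.trans hij)

theorem IsRecord.runningMax_eq {f : Fin N → Fin N} {i : Fin N} (h : IsRecord f i) :
    runningMax f i = f i := by
  obtain ⟨k, hk, hk'⟩ := exists_eq_runningMax f i
  rcases hk.eq_or_lt with rfl | hk
  · exact hk'
  · exact absurd (le_runningMax f le_rfl) (by rw [hk']; exact (h k hk).not_ge)

theorem isRecord_runningMax_iff {f : Fin N → Fin N} {i : Fin N} :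
    IsRecord (runningMax f) i ↔ IsRecord f i := by
  constructor
  · intro h j hj
    obtain ⟨k, hk, hk'⟩ := exists_eq_runningMax f i
    rcases hk.eq_or_lt with rfl | hk
    · exact hk' ▸ (le_runningMax f le_rfl).trans_lt (h j hj)
    · exact absurd (le_runningMax f le_rfl) (by rw [← hk']; exact (h k hk).not_ge)
  · intro h j hj
    obtain ⟨k, hk, hk'⟩ := exists_eq_runningMax f j
    exact hk' ▸ (h k (hk.trans_lt hj)).trans_le (le_runningMax f le_rfl)

theorem le_runningMax_perm (w : Equiv.Perm (Fin N)) (i : Fin N) : i ≤ runningMax w i := by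
  have h : (Finset.Iic i).card ≤ (Finset.Iic (runningMax w i)).card :=
    Finset.card_le_card_of_injOn w
      (fun j hj => by simpa using le_runningMax w (by simpa using hj)) w.injective.injOn
  simp only [Fin.card_Iic] at h
  omega

/-- A value of a function is first attained at a record, if the function is monotone. -/
theorem exists_record_eq {M : Fin N → Fin N} (hM : Monotone M) (i : Fin N) :
    ∃ j ≤ i, IsRecord M j ∧ M j = M i := by
  induction i using WellFoundedLT.induction with
  | _ i ih =>
    by_cases h : IsRecord M i
    · exact ⟨i, le_rfl, h, rfl⟩
    · simp only [IsRecord, not_forall, not_lt] at h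
      obtain ⟨k, hk, hle⟩ := h
      obtain ⟨j, hj, hrec, heq⟩ := ih k hk
      exact ⟨j, hj.trans hk.le, hrec, heq.trans (le_antisymm (hM hk.le) hle)⟩

theorem Avoids321.eq_of_runningMax_eq {w w' : Equiv.Perm (Fin N)} (hw : Avoids321 w)
    (hw' : Avoids321 w') (h : runningMax w = runningMax w') : w = w' := by
  have key {u v : Equiv.Perm (Fin N)} (hv : Avoids321 v) (huv : runningMax u = runningMax v)
      (i : Fin N) (ih : ∀ j < i, u j = v j) : ¬ u i < v i := by
    intro hlt
    have hrec : ¬ IsRecord v i := by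
      intro hrec
      have hrec' : IsRecord u i := by
        rw [← isRecord_runningMax_iff, huv, isRecord_runningMax_iff]
        exact hrec
      rw [← hrec.runningMax_eq, ← hrec'.runningMax_eq, huv] at hlt
      exact lt_irrefl _ hlt
    simp only [IsRecord, not_forall, not_lt] at hrec
    obtain ⟨k, hk, hle⟩ := hrec
    obtain ⟨j, hj⟩ := v.surjective (u i)
    have hij : i < j := by
      by_contra! hji
      rcases hji.eq_or_lt with rfl | hji
      · exact hlt.ne hj.symm
      · rw [← ih j hji] at hj
        exact hji.ne (u.injective hj)
    exact hv k i j hk hij (lt_of_le_of_ne hle fun h => hk.ne (v.injective h).symm) (hj ▸ hlt)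
  ext1 i
  induction i using WellFoundedLT.induction with
  | _ i ih =>
    exact le_antisymm (not_lt.1 (key hw h.symm i fun j hj => (ih j hj).symm))
      (not_lt.1 (key hw' h i ih))

theorem card_later_smaller_of_isRecord {w : Equiv.Perm (Fin N)} {i : Fin N} (h : IsRecord w i) :
    (Finset.univ.filter fun j => i < j ∧ w j < w i).card = (w i : ℕ) - i := by
  have hsplit : (Finset.univ.filter fun j => w j < w i) =
      Finset.Iio i ∪ Finset.univ.filter fun j => i < j ∧ w j < w i := by
    ext j
    simp only [Finset.mem_filter, Finset.mem_univ, true_and, Finset.mem_union, Finset.mem_Iio]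
    constructor
    · intro hj
      rcases lt_trichotomy j i with hji | rfl | hji
      · exact Or.inl hji
      · exact absurd hj (lt_irrefl _)
      · exact Or.inr ⟨hji, hj⟩
    · rintro (hj | hj)
      · exact h j hj
      · exact hj.2
  have hdisj : Disjoint (Finset.Iio i) (Finset.univ.filter fun j => i < j ∧ w j < w i) := by
    rw [Finset.disjoint_left]
    intro j hj hj'
    simp only [Finset.mem_filter, Finset.mem_univ, true_and, Finset.mem_Iio] at hj hj'
    exact hj.not_gt hj'.1
  have hcard : (Finset.univ.filter fun j => w j < w i).card = w i := by
    rw [← Fin.card_Iio (w i)]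
    exact Finset.card_nbij' w w.symm (fun j hj => by simpa using hj)
      (fun j hj => by simpa using hj) (fun j _ => by simp) (fun j _ => by simp)
  rw [hsplit, Finset.card_union_of_disjoint hdisj, Fin.card_Iio] at hcard
  omega

theorem Avoids321.card_inversions {w : Equiv.Perm (Fin N)} (hw : Avoids321 w) :
    (inversions w).card =
      ∑ i with IsRecord (runningMax w) i, ((runningMax w i : ℕ) - i) := by
  have hfib : (inversions w).card =
      ∑ i, (Finset.univ.filter fun j => i < j ∧ w j < w i).card := by
    rw [inversions, ← Finset.univ_product_univ, Finset.card_filter, Finset.sum_product]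
    exact Finset.sum_congr rfl fun i _ => (Finset.card_filter _ _).symm
  rw [hfib, Finset.sum_filter]
  refine Finset.sum_congr rfl fun i _ => ?_
  rw [isRecord_runningMax_iff]
  split_ifs with h
  · rw [card_later_smaller_of_isRecord h, h.runningMax_eq]
  · rw [Finset.card_eq_zero, Finset.filter_eq_empty_iff]
    rintro j - ⟨hij, hlt⟩
    simp only [IsRecord, not_forall, not_lt] at h
    obtain ⟨k, hk, hle⟩ := h
    exact hw k i j hk hij (lt_of_le_of_ne hle fun h => hk.ne (w.injective h).symm) hlt

theorem exists_avoids321_runningMax_eq {M : Fin N → Fin N} (hM : Monotone M)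
    (hle : ∀ i, i ≤ M i) : ∃ w : Equiv.Perm (Fin N), Avoids321 w ∧ runningMax w = M := by
  have hinj {i j : Fin N} (hi : IsRecord M i) (hj : IsRecord M j) (h : M i = M j) : i = j := by
    rcases lt_trichotomy i j with hij | hij | hij
    · exact absurd h (hj i hij).ne
    · exact hij
    · exact absurd h (hi j hij).ne'
  let e : {i // IsRecord M i} ≃ {v // v ∈ Set.range M} :=
    Equiv.ofBijective (fun i => ⟨M i, i, rfl⟩) (by
      constructor
      · rintro ⟨i, hi⟩ ⟨j, hj⟩ h
        exact Subtype.ext (hinj hi hj (congrArg Subtype.val h))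
      · rintro ⟨_, i, rfl⟩
        obtain ⟨j, -, hj, h⟩ := exists_record_eq hM i
        exact ⟨⟨j, hj⟩, Subtype.ext h⟩)
  have hcard : Fintype.card {i // ¬ IsRecord M i} = Fintype.card {v // v ∉ Set.range M} := by
    rw [Fintype.card_subtype_compl, Fintype.card_subtype_compl, Fintype.card_congr e]
  let f : {i // ¬ IsRecord M i} ≃o {v // v ∉ Set.range M} :=
    (Fintype.orderIsoFinOfCardEq _ hcard).symm.trans (Fintype.orderIsoFinOfCardEq _ rfl)
  let w : Equiv.Perm (Fin N) := Equiv.subtypeCongr e f.toEquiv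
  have hw {i : Fin N} (hi : IsRecord M i) : w i = M i := by
    simp only [w, Equiv.subtypeCongr, Equiv.trans_apply, Equiv.sumCompl_symm_apply_of_pos hi]
    rfl
  have hw' {i j : Fin N} (hi : ¬ IsRecord M i) (hj : ¬ IsRecord M j) (hij : i < j) :
      w i < w j := by
    have : f ⟨i, hi⟩ < f ⟨j, hj⟩ := f.strictMono (by simpa using hij)
    simpa [w, Equiv.subtypeCongr, Equiv.sumCompl_symm_apply_of_neg hi,
      Equiv.sumCompl_symm_apply_of_neg hj] using this
  have hbound (i : Fin N) : w i ≤ M i := by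
    by_cases hi : IsRecord M i
    · exact (hw hi).le
    by_contra! hlt
    have hmaps : Set.MapsTo w (Finset.Ici i : Finset (Fin N)) (Finset.Ioi i : Finset (Fin N)) := by
      intro j hj
      simp only [Finset.coe_Ici, Set.mem_Ici, Finset.coe_Ioi, Set.mem_Ioi] at hj ⊢
      refine (hle i).trans_lt ?_
      rcases hj.eq_or_lt with rfl | hj
      · exact hlt
      by_cases hj' : IsRecord M j
      · rw [hw hj']
        exact hj' i hj
      · exact hlt.trans (hw' hi hj' hj)
    have := Finset.card_le_card_of_injOn w hmaps w.injective.injOn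
    simp only [Fin.card_Ici, Fin.card_Ioi] at this
    omega
  refine ⟨w, fun a b c hab hbc h₁ h₂ => ?_, ?_⟩
  · have hrec {i j : Fin N} (hij : i < j) (h : w j < w i) (hi : IsRecord M i) :
        ¬ IsRecord M j := fun hj => by
      rw [hw hi, hw hj] at h
      exact h.not_gt (hj i hij)
    by_cases hb : IsRecord M b
    · by_cases ha : IsRecord M a
      · exact hrec hab h₁ ha hb
      · by_cases hc : IsRecord M c
        · exact hrec hbc h₂ hb hc
        · exact (h₂.trans h₁).not_gt (hw' ha hc (hab.trans hbc))
    · by_cases hc : IsRecord M c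
      · by_cases ha : IsRecord M a
        · exact hrec (hab.trans hbc) (h₂.trans h₁) ha hc
        · exact h₁.not_gt (hw' ha hb hab)
      · exact h₂.not_gt (hw' hb hc hbc)
  · ext1 i
    refine le_antisymm ?_ ?_
    · obtain ⟨j, hj, h⟩ := exists_eq_runningMax w i
      exact h ▸ (hbound j).trans (hM hj)
    · obtain ⟨j, hj, hrec, h⟩ := exists_record_eq hM i
      rw [← h, ← hw hrec]
      exact le_runningMax w hj

end RunningMax

section DyckPaths

variable {N : ℕ}

theorem downStep_strictMono {M : Fin N → Fin N} (hM : Monotone M) : StrictMono (downStep M) := by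
  intro i j hij
  have := hM hij.le
  simp only [downStep]
  omega

theorem upSteps_inter_range_card {M : Fin N → Fin N} (hM : Monotone M) {t : ℕ}
    (ht : t ≤ 2 * N) :
    (upSteps M ∩ Finset.range t).card + (Finset.univ.filter fun i => downStep M i < t).card
      = t := by
  have h₁ : upSteps M ∩ Finset.range t =
      Finset.range t \ (Finset.univ.filter fun i => downStep M i < t).image (downStep M) := by
    ext x
    simp only [upSteps, Finset.mem_inter, Finset.mem_sdiff, Finset.mem_range, Finset.mem_image,
      Finset.mem_univ, true_and, Finset.mem_filter, not_exists, not_and]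
    constructor
    · rintro ⟨⟨-, h⟩, hx⟩
      exact ⟨hx, fun i _ => h i⟩
    · rintro ⟨hx, h⟩
      exact ⟨⟨by omega, fun i hi => h i (by omega) hi⟩, hx⟩
  have h₂ : (Finset.univ.filter fun i => downStep M i < t).image (downStep M) ⊆
      Finset.range t := by
    intro x hx
    simp only [Finset.mem_image, Finset.mem_filter, Finset.mem_univ, true_and] at hx
    obtain ⟨i, hi, rfl⟩ := hx
    simpa using hi
  rw [h₁, ← Finset.card_image_of_injective (Finset.univ.filter fun i => downStep M i < t)
    (downStep_strictMono hM).injective]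
  have := Finset.card_sdiff_add_card_eq_card h₂
  rwa [Finset.card_range] at this

theorem downStep_lt (M : Fin N → Fin N) (i : Fin N) : downStep M i < 2 * N := by
  simp only [downStep]
  omega

theorem upSteps_subset (M : Fin N → Fin N) : upSteps M ⊆ Finset.range (2 * N) :=
  Finset.sdiff_subset

theorem mem_upSteps {M : Fin N → Fin N} {x : ℕ} :
    x ∈ upSteps M ↔ x < 2 * N ∧ ∀ i, downStep M i ≠ x := by
  simp [upSteps]

theorem upSteps_mem_dyckPaths {M : Fin N → Fin N} (hM : Monotone M) (hle : ∀ i, i ≤ M i) :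
    upSteps M ∈ dyckPaths N := by
  simp only [dyckPaths, Finset.mem_filter, Finset.mem_powerset]
  refine ⟨upSteps_subset M, ?_, fun t ht => ?_⟩
  · have h := upSteps_inter_range_card hM le_rfl
    rw [Finset.inter_eq_left.2 (upSteps_subset M),
      Finset.filter_true_of_mem fun i _ => downStep_lt M i, Finset.card_univ,
      Fintype.card_fin] at h
    omega
  · have h := upSteps_inter_range_card hM (t := t) (by simp at ht; omega)
    suffices 2 * (Finset.univ.filter fun i => downStep M i < t).card ≤ t by omega
    have hsub : ((Finset.univ.filter fun i => downStep M i < t).image fun i : Fin N => (i : ℕ)) ⊆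
        Finset.range (t / 2) := by
      intro x hx
      simp only [Finset.mem_image, Finset.mem_filter, Finset.mem_univ, true_and] at hx
      obtain ⟨i, hi, rfl⟩ := hx
      have := hle i
      simp only [downStep] at hi
      rw [Finset.mem_range]
      omega
    have := Finset.card_le_card hsub
    rw [Finset.card_image_of_injective _ Fin.val_injective, Finset.card_range] at this
    omega

theorem upSteps_injOn {M M' : Fin N → Fin N} (hM : Monotone M) (hM' : Monotone M')
    (h : upSteps M = upSteps M') : M = M' := by
  have hrange {M M' : Fin N → Fin N} (h : upSteps M = upSteps M') :
      Set.range (downStep M) ⊆ Set.range (downStep M') := by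
    rintro _ ⟨i, rfl⟩
    by_contra hx
    have : downStep M i ∈ upSteps M' :=
      mem_upSteps.2 ⟨downStep_lt M i, fun j hj => hx ⟨j, hj⟩⟩
    rw [← h] at this
    exact (mem_upSteps.1 this).2 i rfl
  have := ((downStep_strictMono hM).range_inj (downStep_strictMono hM')).1
    ((hrange h).antisymm (hrange h.symm))
  ext i
  have := congrFun this i
  simp only [downStep] at this
  omega

theorem exists_upSteps_eq {U : Finset ℕ} (hU : U ∈ dyckPaths N) :
    ∃ M : Fin N → Fin N, Monotone M ∧ (∀ i, i ≤ M i) ∧ upSteps M = U := by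
  simp only [dyckPaths, Finset.mem_filter, Finset.mem_powerset] at hU
  obtain ⟨hsub, hcard, hU⟩ := hU
  have hD : (Finset.range (2 * N) \ U).card = N := by
    rw [Finset.card_sdiff_of_subset hsub, Finset.card_range]
    omega
  let d := (Finset.range (2 * N) \ U).orderEmbOfFin hD
  have hd (i : Fin N) : d i < 2 * N ∧ d i ∉ U := by
    have h := Finset.orderEmbOfFin_mem (Finset.range (2 * N) \ U) hD i
    rwa [Finset.mem_sdiff, Finset.mem_range] at h
  have hsurj {x : ℕ} (hx : x < 2 * N) (hxU : x ∉ U) : ∃ i, d i = x := by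
    have : x ∈ Set.range d := by
      rw [Finset.range_orderEmbOfFin]
      simpa using ⟨hx, hxU⟩
    exact this
  have hlow (i : Fin N) : 2 * (i : ℕ) + 1 ≤ d i := by
    have hle := hU (d i + 1) (by simpa using (hd i).1)
    have hsub : (Finset.Iic i).image d ⊆ Finset.range (d i + 1) \ U := by
      intro x hx
      simp only [Finset.mem_image, Finset.mem_Iic] at hx
      obtain ⟨j, hj, rfl⟩ := hx
      have := d.monotone hj
      simp only [Finset.mem_sdiff, Finset.mem_range]
      exact ⟨by omega, (hd j).2⟩
    have h₁ := Finset.card_le_card hsub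
    rw [Finset.card_image_of_injective _ d.injective, Fin.card_Iic, Finset.card_sdiff,
      Finset.card_range] at h₁
    have h₂ : (U ∩ Finset.range (d i + 1)).card ≤ d i + 1 := by
      simpa using Finset.card_le_card (Finset.inter_subset_right (s₁ := U)
        (s₂ := Finset.range (d i + 1)))
    omega
  have hup (i : Fin N) : d i ≤ N + i := by
    have hsub : (Finset.Ici i).image d ⊆ Finset.Ico (d i) (2 * N) := by
      intro x hx
      simp only [Finset.mem_image, Finset.mem_Ici] at hx
      obtain ⟨j, hj, rfl⟩ := hx
      simpa using ⟨hj, (hd j).1⟩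
    have h₁ := Finset.card_le_card hsub
    rw [Finset.card_image_of_injective _ d.injective, Fin.card_Ici, Nat.card_Ico] at h₁
    omega
  have hstep {i j : Fin N} (hij : i ≤ j) : d i + (j - i : ℕ) ≤ d j := by
    have hsub : (Finset.Ico i j).image d ⊆ Finset.Ico (d i) (d j) := by
      intro x hx
      simp only [Finset.mem_image, Finset.mem_Ico] at hx
      obtain ⟨k, hk, rfl⟩ := hx
      simpa using hk
    have h₁ := Finset.card_le_card hsub
    rw [Finset.card_image_of_injective _ d.injective, Fin.card_Ico, Nat.card_Ico] at h₁
    have := d.monotone hij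
    omega
  let M : Fin N → Fin N := fun i => ⟨d i - 1 - i, by have := hup i; have := hlow i; omega⟩
  have hdown (i : Fin N) : downStep M i = d i := by
    have := hlow i
    simp only [downStep, M]
    omega
  refine ⟨M, fun i j hij => ?_, fun i => ?_, ?_⟩
  · have h₁ := hstep hij
    have h₂ := hlow i
    simp only [M, Fin.le_def] at hij ⊢
    omega
  · have := hlow i
    simp only [M, Fin.le_def]
    omega
  · ext x
    rw [mem_upSteps]
    constructor
    · rintro ⟨hx, h⟩
      by_contra hxU
      obtain ⟨i, hi⟩ := hsurj hx hxU
      exact h i ((hdown i).trans hi)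
    · intro hx
      refine ⟨by simpa using hsub hx, fun i hi => (hd i).2 ?_⟩
      rwa [← hdown, hi]

theorem peakSet_upSteps {M : Fin N → Fin N} (hM : Monotone M) :
    peakSet N (upSteps M) = (Finset.univ.filter (IsRecord M)).image fun i => (M i : ℕ) + i := by
  ext x
  simp only [peakSet, Finset.mem_filter, Finset.mem_range, mem_upSteps, Finset.mem_image,
    Finset.mem_univ, true_and]
  constructor
  · rintro ⟨hx, ⟨-, hup⟩, hdown, hx'⟩
    simp only [hx', true_and, not_forall, not_not] at hdown
    obtain ⟨i, hi⟩ := hdown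
    simp only [downStep] at hi
    refine ⟨i, fun j hj => ?_, by omega⟩
    obtain ⟨p, hp⟩ : ∃ p : Fin N, (p : ℕ) + 1 = i := ⟨⟨i - 1, by omega⟩, by simp; omega⟩
    have h₁ := hup p
    have h₂ := hM (show j ≤ p by omega)
    have h₃ := hM (show p ≤ i by omega)
    simp only [downStep] at h₁
    omega
  · rintro ⟨i, hi, rfl⟩
    refine ⟨by omega, ⟨by omega, fun j hj => ?_⟩, ?_, by omega⟩
    · simp only [downStep] at hj
      rcases lt_or_ge j i with h | h
      · have := hi j h
        omega
      · have := hM h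
        omega
    · rintro ⟨-, h⟩
      exact h i (by simp only [downStep]; omega)

theorem peakHeight_upSteps {M : Fin N → Fin N} (hM : Monotone M) (hle : ∀ i, i ≤ M i)
    (i : Fin N) : peakHeight (upSteps M) (M i + i) = ((M i : ℕ) - i) + 1 := by
  have h := upSteps_inter_range_card hM (t := M i + i + 1) (by omega)
  have hfilter : (Finset.univ.filter fun j => downStep M j < M i + i + 1) = Finset.Iio i := by
    ext j
    have : downStep M i = M i + i + 1 := by simp only [downStep]; omega
    rw [Finset.mem_filter, ← this, (downStep_strictMono hM).lt_iff_lt]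
    simp
  rw [hfilter, Fin.card_Iio] at h
  have := hle i
  simp only [peakHeight]
  omega

theorem statDiff_upSteps {M : Fin N → Fin N} (hM : Monotone M) (hle : ∀ i, i ≤ M i) :
    statDiff N (upSteps M) = ∑ i with IsRecord M i, ((M i : ℕ) - i) := by
  have hinj : Function.Injective fun i => (M i : ℕ) + i := by
    intro i j h
    refine (downStep_strictMono hM).injective ?_
    simp only [downStep] at h ⊢
    omega
  rw [statDiff, peakSet_upSteps hM, Finset.sum_image hinj.injOn,
    Finset.card_image_of_injective _ hinj,
    Finset.sum_congr rfl fun i _ => peakHeight_upSteps hM hle i, Finset.sum_add_distrib]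
  simp

end DyckPaths

/-- For every `n ≥ 1` and `k ≥ 0`, the number of fully commutative elements of Coxeter
length `k` in `S_{n+1}` equals the number of Dyck paths of semi-length `n+1` with
(sum of peak heights) − (number of peaks) `= k`. -/
theorem card_fullyCommutative_length_eq_T (n : ℕ) (hn : 1 ≤ n) (k : ℕ) :
    Nat.card {w : Equiv.Perm (Fin (n + 1)) //
        FullyCommutative n w ∧ ∃ l : List ℕ, IsReducedWord n w l ∧ l.length = k} =
      T (n + 1) k := by
  have hmem {w : Equiv.Perm (Fin (n + 1))} (hw : Avoids321 w) :
      statDiff (n + 1) (upSteps (runningMax w)) = (inversions w).card := by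
    rw [statDiff_upSteps (runningMax_monotone w) (le_runningMax_perm w), hw.card_inversions]
  simp only [fullyCommutative_iff_avoids321, exists_reducedWord_length_iff]
  rw [Nat.card_eq_fintype_card, Fintype.card_subtype, T]
  refine Finset.card_bij (fun w _ => upSteps (runningMax w)) ?_ ?_ ?_
  · intro w hw
    simp only [Finset.mem_filter, Finset.mem_univ, true_and] at hw ⊢
    exact ⟨upSteps_mem_dyckPaths (runningMax_monotone w) (le_runningMax_perm w),
      (hmem hw.1).trans hw.2⟩
  · intro w hw w' hw' h
    simp only [Finset.mem_filter, Finset.mem_univ, true_and] at hw hw'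
    exact hw.1.eq_of_runningMax_eq hw'.1
      (upSteps_injOn (runningMax_monotone w) (runningMax_monotone w') h)
  · intro U hU
    simp only [Finset.mem_filter, Finset.mem_univ, true_and] at hU ⊢
    obtain ⟨M, hM, hle, rfl⟩ := exists_upSteps_eq hU.1
    obtain ⟨w, hw, rfl⟩ := exists_avoids321_runningMax_eq hM hle
    exact ⟨w, ⟨hw, (hmem hw).symm.trans hU.2⟩, rfl⟩
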